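/- arXiv:0907.1548 — 7 statements merged into one kernel-verified Lean document; each statement's English description precedes it below -/
import Mathlib

section
/- (Artin's theorem) Let A be an alternative algebra over a field K of characteristic 0. Then for any two elements a, b ∈ A, the (non-unital) subalgebra of A generated by {a, b} is associative, i.e. (xy)z = x(yz) for all x, y, z in this subalgebra. -/
/-- The (non-unital, non-associative) subalgebra generated by a set `S`:
the smallest subset of `A` containing `S` that is a `K`-subspace and is
closed under the multiplication `μ`. -/
def genSubalgebra {K A : Type*} [Field K] [AddCommGroup A] [Module K A]
    (μ : A →ₗ[K] A →ₗ[K] A) (S : Set A) : Set A :=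
  ⋂₀ {T : Set A | S ⊆ T ∧ (∃ p : Submodule K A, (p : Set A) = T) ∧
      ∀ x ∈ T, ∀ y ∈ T, μ x y ∈ T}


section Helpers

variable {K A : Type*} [Field K] [AddCommGroup A] [Module K A]

/-- The associator. -/
def asr (μ : A →ₗ[K] A →ₗ[K] A) (x y z : A) : A := μ (μ x y) z - μ x (μ y z)

/-- The Kleinfeld function. -/
def kf (μ : A →ₗ[K] A →ₗ[K] A) (w x y z : A) : A :=
  asr μ (μ w x) y z - μ x (asr μ w y z) - μ (asr μ x y z) w

theorem asr_swap12 (μ : A →ₗ[K] A →ₗ[K] A)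
    (hleft : ∀ x y : A, μ x (μ x y) = μ (μ x x) y) (x y z : A) :
    asr μ y x z = - asr μ x y z := by
  have h := hleft (x + y) z
  simp only [map_add, LinearMap.add_apply, hleft] at h
  unfold asr
  rw [← sub_eq_zero] at h ⊢
  rw [← neg_eq_zero, ← h]
  abel

theorem asr_swap23 (μ : A →ₗ[K] A →ₗ[K] A)
    (hright : ∀ x y : A, μ (μ x y) y = μ x (μ y y)) (x y z : A) :
    asr μ x z y = - asr μ x y z := by
  have h := hright x (y + z)
  simp only [map_add, LinearMap.add_apply, hright] at h
  unfold asr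
  rw [← sub_eq_zero] at h ⊢
  rw [← h]
  abel

theorem teichmuller (μ : A →ₗ[K] A →ₗ[K] A) (w x y z : A) :
    asr μ (μ w x) y z - asr μ w (μ x y) z + asr μ w x (μ y z)
      = μ w (asr μ x y z) + μ (asr μ w x y) z := by
  simp only [asr, map_sub, LinearMap.sub_apply]
  abel

theorem kf_cyc (μ : A →ₗ[K] A →ₗ[K] A)
    (hleft : ∀ x y : A, μ x (μ x y) = μ (μ x x) y)
    (hright : ∀ x y : A, μ (μ x y) y = μ x (μ y y)) (w x y z : A) :
    kf μ w x y z = - kf μ z w x y := by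
  have cyc : ∀ p q r : A, asr μ p q r = asr μ q r p := fun p q r => by
    rw [asr_swap23 μ hright q p r, asr_swap12 μ hleft p q r, neg_neg]
  have key : ∀ w x y z : A, kf μ w x y z - kf μ x y z w + kf μ y z w x
      = (μ w (asr μ x y z) - μ (asr μ x y z) w) - (μ x (asr μ y z w) - μ (asr μ y z w) x)
      + (μ y (asr μ z w x) - μ (asr μ z w x) y) - (μ z (asr μ w x y) - μ (asr μ w x y) z) := by
    intro w x y z
    have t := teichmuller μ w x y z
    rw [cyc w (μ x y) z, ← cyc (μ y z) w x] at t
    unfold kf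
    rw [cyc w y z, cyc x z w, cyc y w x]
    rw [← sub_eq_zero] at t ⊢
    rw [← t]
    abel
  have k1 := key w x y z
  have k2 := key x y z w
  have : kf μ w x y z + kf μ z w x y =
    (kf μ w x y z - kf μ x y z w + kf μ y z w x) +
    (kf μ x y z w - kf μ y z w x + kf μ z w x y) := by abel
  rw [eq_neg_iff_add_eq_zero, this, k1, k2]
  abel

theorem kf_rep (μ : A →ₗ[K] A →ₗ[K] A)
    (hleft : ∀ x y : A, μ x (μ x y) = μ (μ x x) y)
    (hright : ∀ x y : A, μ (μ x y) y = μ x (μ y y)) (a y z : A) :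
    kf μ a y a z = 0 := by
  have s : kf μ a y a z = - kf μ a y z a := by
    unfold kf
    rw [asr_swap23 μ hright _ z a, asr_swap23 μ hright a z a, asr_swap23 μ hright y z a]
    simp only [map_neg, LinearMap.neg_apply]
    abel
  have r : ∀ p : A, asr μ p a a = 0 := fun p => by simp [asr, hright]
  rw [s, kf_cyc μ hleft hright, kf_cyc μ hleft hright, kf_cyc μ hleft hright]
  simp [kf, r]

/-- Nonassociative words in `a`, `b` of given degree. -/
inductive Wd (μ : A →ₗ[K] A →ₗ[K] A) (a b : A) : ℕ → A → Prop
  | left : Wd μ a b 1 a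
  | right : Wd μ a b 1 b
  | mul {m n : ℕ} {x y : A} : Wd μ a b m x → Wd μ a b n y → Wd μ a b (m + n) (μ x y)

theorem Wd.pos {μ : A →ₗ[K] A →ₗ[K] A} {a b : A} {n : ℕ} {x : A} (h : Wd μ a b n x) :
    1 ≤ n := by
  induction h <;> omega

/-- A word of degree `m` starting with the letter `c`. -/
def Hd (μ : A →ₗ[K] A →ₗ[K] A) (a b c : A) (m : ℕ) (u : A) : Prop :=
  (m = 1 ∧ u = c) ∨ ∃ k v, Wd μ a b k v ∧ m = 1 + k ∧ u = μ c v

theorem hd_exists (μ : A →ₗ[K] A →ₗ[K] A) (a b : A) (n : ℕ)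
    (H : ∀ i j k x y z, Wd μ a b i x → Wd μ a b j y → Wd μ a b k z → i + j + k < n →
      asr μ x y z = 0) {m : ℕ} {u : A} (h : Wd μ a b m u) :
    m < n → Hd μ a b a m u ∨ Hd μ a b b m u := by
  have aux : ∀ c i j x y, Wd μ a b 1 c → Wd μ a b j y → i + j < n →
      Hd μ a b c i x → Hd μ a b c (i + j) (μ x y) := by
    intro c i j x y hc hy hl hx
    right
    rcases hx with ⟨rfl, rfl⟩ | ⟨k, v, hv, rfl, rfl⟩
    · exact ⟨j, y, hy, rfl, rfl⟩
    · refine ⟨k + j, μ v y, hv.mul hy, by omega, ?_⟩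
      exact sub_eq_zero.mp (H _ _ _ _ _ _ hc hv hy hl)
  induction h with
  | left => exact fun _ => Or.inl (Or.inl ⟨rfl, rfl⟩)
  | right => exact fun _ => Or.inr (Or.inl ⟨rfl, rfl⟩)
  | mul hx hy ihx _ =>
    intro hl
    rcases ihx (by omega) with h | h
    · exact Or.inl (aux _ _ _ _ _ .left hy hl h)
    · exact Or.inr (aux _ _ _ _ _ .right hy hl h)

theorem asr_same (μ : A →ₗ[K] A →ₗ[K] A)
    (hleft : ∀ x y : A, μ x (μ x y) = μ (μ x x) y)
    (hright : ∀ x y : A, μ (μ x y) y = μ x (μ y y)) (a b c : A) (n : ℕ)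
    (H : ∀ i j k x y z, Wd μ a b i x → Wd μ a b j y → Wd μ a b k z → i + j + k < n →
      asr μ x y z = 0) (hc : Wd μ a b 1 c) {i j k : ℕ} {x y z : A}
    (hx : Hd μ a b c i x) (hy : Hd μ a b c j y) (hz : Wd μ a b k z) (hn : i + j + k = n) :
    asr μ x y z = 0 := by
  have red : ∀ p q r s t v w, Wd μ a b p t → Wd μ a b q v → Wd μ a b r w → ∀ u, Wd μ a b s u →
      p + q + r + s = n → asr μ (μ t v) w u = kf μ t v w u := by
    intro p q r s t v w ht hv hw u hu hs
    have := ht.pos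
    have := hv.pos
    unfold kf
    rw [H _ _ _ _ _ _ ht hw hu (by omega), H _ _ _ _ _ _ hv hw hu (by omega)]
    simp
  have one : ∀ k v l z, Wd μ a b k v → Wd μ a b l z → 1 + k + 1 + l = n →
      asr μ (μ c v) c z = 0 := by
    intro k v l z hv hz hs
    rw [red _ _ _ _ _ _ _ hc hv hc _ hz hs, kf_rep μ hleft hright]
  have hzp := hz.pos
  rcases hx with ⟨rfl, rfl⟩ | ⟨p, u, hu, rfl, rfl⟩ <;>
    rcases hy with ⟨rfl, rfl⟩ | ⟨q, v, hv, rfl, rfl⟩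
  · simp [asr, hleft]
  · rw [asr_swap12 μ hleft, one _ _ _ _ hv hz (by omega), neg_zero]
  · exact one _ _ _ _ hu hz (by omega)
  · have hup := hu.pos
    have e : μ (μ c v) z = μ c (μ v z) := sub_eq_zero.mp (H _ _ _ _ _ _ hc hv hz (by omega))
    rw [red _ _ _ _ _ _ _ hc hu (hc.mul hv) _ hz (by omega), kf_cyc μ hleft hright,
      kf_cyc μ hleft hright, ← red _ _ _ _ _ _ _ (hc.mul hv) hz hc _ hu (by omega), e,
      one _ _ _ _ (hv.mul hz) hu (by omega)]
    simp

theorem asr_words (μ : A →ₗ[K] A →ₗ[K] A)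
    (hleft : ∀ x y : A, μ x (μ x y) = μ (μ x x) y)
    (hright : ∀ x y : A, μ (μ x y) y = μ x (μ y y)) (a b : A) (n : ℕ) :
    ∀ i j k x y z, Wd μ a b i x → Wd μ a b j y → Wd μ a b k z → i + j + k < n →
      asr μ x y z = 0 := by
  induction n with
  | zero => intros; omega
  | succ n H =>
    intro i j k x y z hx hy hz hl
    rcases Nat.lt_succ_iff_lt_or_eq.mp hl with hl | hl
    · exact H _ _ _ _ _ _ hx hy hz hl
    have px := hx.pos
    have py := hy.pos
    have pz := hz.pos
    have same := fun c hc => @asr_same K A _ _ _ μ hleft hright a b c n H hc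
    have xy : ∀ c, Wd μ a b 1 c → Hd μ a b c i x → Hd μ a b c j y → asr μ x y z = 0 :=
      fun c hc h1 h2 => same c hc h1 h2 hz hl
    have xz : ∀ c, Wd μ a b 1 c → Hd μ a b c i x → Hd μ a b c k z → asr μ x y z = 0 :=
      fun c hc h1 h2 => by
        rw [asr_swap23 μ hright, same c hc h1 h2 hy (by omega), neg_zero]
    have yz : ∀ c, Wd μ a b 1 c → Hd μ a b c j y → Hd μ a b c k z → asr μ x y z = 0 :=
      fun c hc h1 h2 => by
        rw [asr_swap12 μ hleft, asr_swap23 μ hright, same c hc h1 h2 hx (by omega)]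
        simp
    rcases hd_exists μ a b n H hx (by omega) with h1 | h1 <;>
    rcases hd_exists μ a b n H hy (by omega) with h2 | h2 <;>
    rcases hd_exists μ a b n H hz (by omega) with h3 | h3
    · exact xy _ .left h1 h2
    · exact xy _ .left h1 h2
    · exact xz _ .left h1 h3
    · exact yz _ .right h2 h3
    · exact yz _ .left h2 h3
    · exact xz _ .right h1 h3
    · exact xy _ .right h1 h2
    · exact xy _ .right h1 h2

end Helpers

/-- Artin's theorem: in an alternative algebra, the subalgebra generated by
any two elements is associative. -/
theorem artin_two_generated_associative
    {K A : Type*} [Field K] [CharZero K] [AddCommGroup A] [Module K A]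
    (μ : A →ₗ[K] A →ₗ[K] A)
    (hleft : ∀ x y : A, μ x (μ x y) = μ (μ x x) y)
    (hright : ∀ x y : A, μ (μ x y) y = μ x (μ y y))
    (a b : A) :
    ∀ x ∈ genSubalgebra μ {a, b}, ∀ y ∈ genSubalgebra μ {a, b},
      ∀ z ∈ genSubalgebra μ {a, b}, μ (μ x y) z = μ x (μ y z) := by
  classical
  set p : Submodule K A := Submodule.span K {x | ∃ n, Wd μ a b n x} with hp
  have sub : genSubalgebra μ {a, b} ⊆ (p : Set A) := by
    apply Set.sInter_subset_of_mem
    refine ⟨?_, ⟨p, rfl⟩, ?_⟩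
    · rintro x (rfl | rfl)
      · exact Submodule.subset_span ⟨1, .left⟩
      · exact Submodule.subset_span ⟨1, .right⟩
    · intro x hx y hy
      refine Submodule.span_induction₂ (p := fun x y _ _ => μ x y ∈ p)
        ?_ ?_ ?_ ?_ ?_ ?_ ?_ hx hy
      · rintro x y ⟨m, h⟩ ⟨n, h'⟩
        exact Submodule.subset_span ⟨_, h.mul h'⟩
      · intro y _; simp
      · intro y _; simp
      · intro x y z _ _ _ h h'; simpa using p.add_mem h h'
      · intro x y z _ _ _ h h'; simpa using p.add_mem h h'
      · intro r x y _ _ h; simpa using p.smul_mem r h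
      · intro r x y _ _ h; simpa using p.smul_mem r h
  intro x hx y hy z hz
  replace hx := sub hx
  replace hy := sub hy
  replace hz := sub hz
  have w1 : ∀ x ∈ {x | ∃ n, Wd μ a b n x}, ∀ y ∈ {x | ∃ n, Wd μ a b n x},
      μ (μ x y) z = μ x (μ y z) := by
    rintro x ⟨i, h1⟩ y ⟨j, h2⟩
    induction hz using Submodule.span_induction with
    | mem z h =>
      obtain ⟨k, h3⟩ := h
      exact sub_eq_zero.mp
        (asr_words μ hleft hright a b (i + j + k + 1) _ _ _ _ _ _ h1 h2 h3 (by omega))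
    | zero => simp
    | add u v _ _ h h' => simp [h, h']
    | smul r u _ h => simp [h]
  refine Submodule.span_induction₂ (p := fun x y _ _ => μ (μ x y) z = μ x (μ y z))
        (fun x y hx hy => w1 x hx y hy) ?_ ?_ ?_ ?_ ?_ ?_ hx hy
  · intro y _; simp
  · intro y _; simp
  · intro x y z _ _ _ h h'; simp [h, h']
  · intro x y z _ _ _ h h'; simp [h, h']
  · intro r x y _ _ h; simp [h]
  · intro r x y _ _ h; simp [h]
end

section
/- (Generalization of Artin's theorem) Let A be an alternative algebra over a field K of characteristic 0 and let a, b, c ∈ A be three elements that associate, i.e. (ab)c − a(bc) = 0. Then the (non-unital) subalgebra of A generated by {a, b, c} is associative, i.e. (xy)z = x(yz) for all x, y, z in this subalgebra. -/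
/-- `ArtinMono μ S n x`: `x` is a nonassociative monomial of degree `n` in elements of `S`. -/
inductive ArtinMono {K A : Type*} [Field K] [AddCommGroup A] [Module K A]
    (μ : A →ₗ[K] A →ₗ[K] A) (S : Set A) : ℕ → A → Prop
  | letter (x : A) (hx : x ∈ S) : ArtinMono μ S 1 x
  | prod (i j : ℕ) (x y : A) (hx : ArtinMono μ S i x) (hy : ArtinMono μ S j y) :
      ArtinMono μ S (i + j) (μ x y)

/-- The associator. -/
def artinAssoc {K A : Type*} [Field K] [AddCommGroup A] [Module K A]
    (μ : A →ₗ[K] A →ₗ[K] A) (x y z : A) : A := μ (μ x y) z - μ x (μ y z)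

section
variable {K A : Type*} [Field K] [AddCommGroup A] [Module K A] {μ : A →ₗ[K] A →ₗ[K] A}

theorem ArtinMono.pos {S : Set A} {n : ℕ} {x : A} (h : ArtinMono μ S n x) : 1 ≤ n := by
  induction h with
  | letter => exact le_rfl
  | prod i j x y _ _ h1 h2 => omega

theorem ArtinMono.cases_prod {S : Set A} {n : ℕ} {x : A} (h : ArtinMono μ S n x) :
    x ∈ S ∨ ∃ i j p q, ArtinMono μ S i p ∧ ArtinMono μ S j q ∧ i + j = n ∧ x = μ p q := by
  cases h with
  | letter _ hx => exact Or.inl hx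
  | prod i j p q hp hq => exact Or.inr ⟨i, j, p, q, hp, hq, rfl, rfl⟩

theorem artin_self_neg [CharZero K] {x : A} (h : x = -x) : x = 0 := by
  have h2 : (2 : K) • x = 0 := by
    rw [two_smul]; nth_rewrite 1 [h]; simp
  exact (smul_eq_zero.mp h2).resolve_left two_ne_zero

theorem artinAssoc_swap12 (hleft : ∀ x y : A, μ x (μ x y) = μ (μ x x) y) (x y z : A) :
    artinAssoc μ x y z = - artinAssoc μ y x z := by
  have h := hleft (x + y) z
  simp only [map_add, LinearMap.add_apply, hleft] at h
  have h' : μ x (μ y z) + μ y (μ x z) = μ (μ y x) z + μ (μ x y) z := by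
    rw [← sub_eq_zero] at h ⊢
    rw [← h]; abel
  rw [← sub_eq_zero] at h' ⊢
  unfold artinAssoc
  rw [← neg_eq_zero, ← h']; abel

theorem artinAssoc_swap23 (hright : ∀ x y : A, μ (μ x y) y = μ x (μ y y)) (x y z : A) :
    artinAssoc μ x y z = - artinAssoc μ x z y := by
  have h := hright x (y + z)
  simp only [map_add, LinearMap.add_apply, hright] at h
  have h' : μ (μ x y) z + μ (μ x z) y = μ x (μ y z) + μ x (μ z y) := by
    rw [← sub_eq_zero] at h ⊢
    rw [← h]; abel
  rw [← sub_eq_zero] at h' ⊢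
  unfold artinAssoc
  rw [← h']; abel

theorem artinAssoc_teich (w x y z : A) :
    artinAssoc μ (μ w x) y z - artinAssoc μ w (μ x y) z + artinAssoc μ w x (μ y z)
      = μ w (artinAssoc μ x y z) + μ (artinAssoc μ w x y) z := by
  simp only [artinAssoc, map_sub, LinearMap.sub_apply]; abel

theorem artin_mono_assoc [CharZero K]
    (hleft : ∀ x y : A, μ x (μ x y) = μ (μ x x) y)
    (hright : ∀ x y : A, μ (μ x y) y = μ x (μ y y))
    (a b c : A) (habc : artinAssoc μ a b c = 0) (n : ℕ) :
    ∀ i j k x y z, ArtinMono μ {a, b, c} i x → ArtinMono μ {a, b, c} j y →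
      ArtinMono μ {a, b, c} k z → i + j + k = n → artinAssoc μ x y z = 0 := by
  have s12 := artinAssoc_swap12 hleft
  have s23 := artinAssoc_swap23 hright
  have cyc : ∀ x y z, artinAssoc μ x y z = artinAssoc μ y z x := fun x y z => by
    rw [s12 x y z, s23 y x z, neg_neg]
  induction n using Nat.strong_induction_on with
  | _ n ih =>
  -- vanishing of associators of smaller degree
  have rot : ∀ i j k l w x y z, ArtinMono μ {a, b, c} i w → ArtinMono μ {a, b, c} j x →
      ArtinMono μ {a, b, c} k y → ArtinMono μ {a, b, c} l z → i + j + k + l = n →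
      artinAssoc μ (μ w x) y z = - artinAssoc μ (μ x y) z w := by
    intro i j k l w x y z hw hx hy hz hn
    have p1 := hw.pos
    have p2 := hx.pos
    have p3 := hy.pos
    have p4 := hz.pos
    have t1 := artinAssoc_teich (μ := μ) w x y z
    have t2 := artinAssoc_teich (μ := μ) x y z w
    rw [ih (j + k + l) (by omega) j k l x y z hx hy hz rfl,
      ih (i + j + k) (by omega) i j k w x y hw hx hy rfl] at t1
    rw [ih (k + l + i) (by omega) k l i y z w hy hz hw rfl,
      ih (j + k + l) (by omega) j k l x y z hx hy hz rfl] at t2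
    rw [cyc w (μ x y) z, ← cyc (μ y z) w x] at t1
    rw [cyc x (μ y z) w, ← cyc (μ z w) x y] at t2
    simp only [map_zero, LinearMap.zero_apply, add_zero] at t1 t2
    have t3 := artinAssoc_teich (μ := μ) y z w x
    rw [ih (k + l + i) (by omega) k l i y z w hy hz hw rfl,
      ih (l + i + j) (by omega) l i j z w x hz hw hx rfl] at t3
    rw [cyc y (μ z w) x, ← cyc (μ w x) y z] at t3
    simp only [map_zero, LinearMap.zero_apply, add_zero] at t3
    have e : artinAssoc μ (μ w x) y z + artinAssoc μ (μ x y) z w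
      = (artinAssoc μ (μ y z) w x - artinAssoc μ (μ z w) x y + artinAssoc μ (μ w x) y z)
       + (artinAssoc μ (μ x y) z w - artinAssoc μ (μ y z) w x + artinAssoc μ (μ z w) x y) := by
      abel
    rw [t2, t3, add_zero] at e
    exact eq_neg_of_add_eq_zero_left e
  have swap : ∀ i j k l w x y z, ArtinMono μ {a, b, c} i w → ArtinMono μ {a, b, c} j x →
      ArtinMono μ {a, b, c} k y → ArtinMono μ {a, b, c} l z → i + j + k + l = n →
      artinAssoc μ (μ w x) y z = - artinAssoc μ (μ x w) y z := by
    intro i j k l w x y z hw hx hy hz hn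
    rw [rot i j k l w x y z hw hx hy hz hn, rot j k l i x y z w hx hy hz hw (by omega),
      s23 (μ y z) w x, rot k l j i y z x w hy hz hx hw (by omega),
      rot l j i k z x w y hz hx hw hy (by omega), s23 (μ x w) y z]
    simp
  have hh : ∀ i j k l m r s q v w, ArtinMono μ {a, b, c} i r → ArtinMono μ {a, b, c} j s →
      ArtinMono μ {a, b, c} k q → ArtinMono μ {a, b, c} l v → ArtinMono μ {a, b, c} m w →
      i + j + k + l + m = n →
      artinAssoc μ (μ (μ r s) q) v w = - artinAssoc μ (μ (μ s q) r) v w := by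
    intro i j k l m r s q v w hr hs hq hv hw hn
    have p4 := hv.pos
    have h0 := ih (i + j + k) (by omega) i j k r s q hr hs hq rfl
    rw [sub_eq_zero.mp h0]
    exact swap i (j + k) l m r (μ s q) v w hr (.prod _ _ _ _ hs hq) hv hw (by omega)
  have h5 : ∀ i j k l m r s q v w, ArtinMono μ {a, b, c} i r → ArtinMono μ {a, b, c} j s →
      ArtinMono μ {a, b, c} k q → ArtinMono μ {a, b, c} l v → ArtinMono μ {a, b, c} m w →
      i + j + k + l + m = n → artinAssoc μ (μ (μ r s) q) v w = 0 := by
    intro i j k l m r s q v w hr hs hq hv hw hn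
    apply artin_self_neg (K := K)
    nth_rewrite 1 [hh i j k l m r s q v w hr hs hq hv hw hn]
    rw [hh j k i l m s q r v w hs hq hr hv hw (by omega),
      hh k i j l m q r s v w hq hr hs hv hw (by omega)]
    simp
  have h4 : ∀ i j k l w x y z, ArtinMono μ {a, b, c} i w → ArtinMono μ {a, b, c} j x →
      ArtinMono μ {a, b, c} k y → ArtinMono μ {a, b, c} l z → i + j + k + l = n →
      artinAssoc μ (μ w x) y z = 0 := by
    intro i j k l w x y z hw hx hy hz hn
    rcases hw.cases_prod with lw | ⟨i', j', p, q, hp, hq, rfl, rfl⟩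
    swap
    · exact h5 _ _ _ _ _ _ _ _ _ _ hp hq hx hy hz (by omega)
    have r1 := rot i j k l w x y z hw hx hy hz hn
    rcases hx.cases_prod with lx | ⟨i', j', p, q, hp, hq, rfl, rfl⟩
    swap
    · rw [r1, h5 _ _ _ _ _ _ _ _ _ _ hp hq hy hz hw (by omega), neg_zero]
    have r2 := rot j k l i x y z w hx hy hz hw (by omega)
    rcases hy.cases_prod with ly | ⟨i', j', p, q, hp, hq, rfl, rfl⟩
    swap
    · rw [r1, r2, h5 _ _ _ _ _ _ _ _ _ _ hp hq hz hw hx (by omega), neg_zero, neg_zero]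
    have r3 := rot k l i j y z w x hy hz hw hx (by omega)
    rcases hz.cases_prod with lz | ⟨i', j', p, q, hp, hq, rfl, rfl⟩
    swap
    · rw [r1, r2, r3, h5 _ _ _ _ _ _ _ _ _ _ hp hq hw hx hy (by omega)]; simp
    have w12 := swap i j k l w x y z hw hx hy hz hn
    have w23 := swap j k l i x y z w hx hy hz hw (by omega)
    -- the six ways in which two letters can coincide
    have e12 : w = x → artinAssoc μ (μ w x) y z = 0 := by
      rintro rfl; exact artin_self_neg (K := K) w12
    have e34 : y = z → artinAssoc μ (μ w x) y z = 0 := by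
      rintro rfl; exact artin_self_neg (K := K) (s23 _ _ _)
    have e23 : x = y → artinAssoc μ (μ w x) y z = 0 := by
      rintro rfl; rw [r1, artin_self_neg (K := K) w23, neg_zero]
    have e14 : w = z → artinAssoc μ (μ w x) y z = 0 := by
      rintro rfl; rw [r1, artin_self_neg (K := K) (s23 (μ x y) w w), neg_zero]
    have r5 := rot j i k l x w y z hx hw hy hz (by omega)
    have w5 := swap i k l j w y z x hw hy hz hx (by omega)
    have e13 : w = y → artinAssoc μ (μ w x) y z = 0 := by
      rintro rfl; rw [w12, r5, artin_self_neg (K := K) w5, neg_zero, neg_zero]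
    have e24 : x = z → artinAssoc μ (μ w x) y z = 0 := by
      rintro rfl
      rw [w12, r5, artin_self_neg (K := K) (s23 (μ w y) x x), neg_zero, neg_zero]
    simp only [Set.mem_insert_iff, Set.mem_singleton_iff] at lw lx ly lz
    rcases lw with h1 | h1 | h1 <;> rcases lx with h2 | h2 | h2 <;>
      rcases ly with h3 | h3 | h3 <;> rcases lz with h4 | h4 | h4 <;>
      first
        | exact e12 (h1.trans h2.symm)
        | exact e13 (h1.trans h3.symm)
        | exact e14 (h1.trans h4.symm)
        | exact e23 (h2.trans h3.symm)
        | exact e24 (h2.trans h4.symm)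
        | exact e34 (h3.trans h4.symm)
  intro i j k x y z hx hy hz hn
  rcases hx.cases_prod with lx | ⟨i', j', p, q, hp, hq, rfl, rfl⟩
  swap
  · exact h4 _ _ _ _ _ _ _ _ hp hq hy hz (by omega)
  rcases hy.cases_prod with ly | ⟨i', j', p, q, hp, hq, rfl, rfl⟩
  swap
  · rw [cyc]; exact h4 _ _ _ _ _ _ _ _ hp hq hz hx (by omega)
  rcases hz.cases_prod with lz | ⟨i', j', p, q, hp, hq, rfl, rfl⟩
  swap
  · rw [cyc, cyc]; exact h4 _ _ _ _ _ _ _ _ hp hq hx hy (by omega)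
  have n12 : ∀ x y, artinAssoc μ x x y = 0 := fun x y => artin_self_neg (K := K) (s12 x x y)
  have n23 : ∀ x y, artinAssoc μ x y y = 0 := fun x y => artin_self_neg (K := K) (s23 x y y)
  have n13 : ∀ x y, artinAssoc μ x y x = 0 := fun x y => by rw [cyc, n23]
  have hbca : artinAssoc μ b c a = 0 := by rw [← cyc, habc]
  have hcab : artinAssoc μ c a b = 0 := by rw [cyc, habc]
  have hbac : artinAssoc μ b a c = 0 := by rw [s12, habc, neg_zero]
  have hacb : artinAssoc μ a c b = 0 := by rw [s23, habc, neg_zero]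
  have hcba : artinAssoc μ c b a = 0 := by rw [s12, hbca, neg_zero]
  simp only [Set.mem_insert_iff, Set.mem_singleton_iff] at lx ly lz
  rcases lx with h1 | h1 | h1 <;> rcases ly with h2 | h2 | h2 <;>
    rcases lz with h3 | h3 | h3 <;> rw [h1, h2, h3] <;>
    first
      | assumption
      | exact n12 _ _
      | exact n23 _ _
      | exact n13 _ _

theorem genSubalgebra_subset_span (S : Set A) :
    genSubalgebra μ S ⊆ ((Submodule.span K {x | ∃ n, ArtinMono μ S n x} : Submodule K A) : Set A) := by
  apply Set.sInter_subset_of_mem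
  refine ⟨fun x hx => Submodule.subset_span ⟨1, .letter x hx⟩, ⟨_, rfl⟩, ?_⟩
  intro x hx y hy
  simp only [SetLike.mem_coe] at hx hy ⊢
  induction hx using Submodule.span_induction with
  | zero => simp
  | add u v _ _ hu hv => rw [map_add, LinearMap.add_apply]; exact add_mem hu hv
  | smul t u _ hu => rw [map_smul, LinearMap.smul_apply]; exact Submodule.smul_mem _ _ hu
  | mem x hx =>
    obtain ⟨m, hm⟩ := hx
    induction hy using Submodule.span_induction with
    | zero => simp
    | add u v _ _ hu hv => rw [map_add]; exact add_mem hu hv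
    | smul t u _ hu => rw [map_smul]; exact Submodule.smul_mem _ _ hu
    | mem y hy =>
      obtain ⟨n, hn⟩ := hy
      exact Submodule.subset_span ⟨m + n, .prod _ _ _ _ hm hn⟩
end

/-- Generalization of Artin's theorem: in an alternative algebra, if three
elements associate then the subalgebra they generate is associative. -/
theorem artin_three_generated_associative
    {K A : Type*} [Field K] [CharZero K] [AddCommGroup A] [Module K A]
    (μ : A →ₗ[K] A →ₗ[K] A)
    (hleft : ∀ x y : A, μ x (μ x y) = μ (μ x x) y)
    (hright : ∀ x y : A, μ (μ x y) y = μ x (μ y y))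
    (a b c : A) (habc : μ (μ a b) c - μ a (μ b c) = 0) :
    ∀ x ∈ genSubalgebra μ {a, b, c}, ∀ y ∈ genSubalgebra μ {a, b, c},
      ∀ z ∈ genSubalgebra μ {a, b, c}, μ (μ x y) z = μ x (μ y z) := by
  intro x hx y hy z hz
  replace hx := genSubalgebra_subset_span _ hx
  replace hy := genSubalgebra_subset_span _ hy
  replace hz := genSubalgebra_subset_span _ hz
  simp only [SetLike.mem_coe] at hx hy hz
  induction hx using Submodule.span_induction with
  | zero => simp
  | add u v _ _ hu hv => simp only [map_add, LinearMap.add_apply, hu, hv]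
  | smul t u _ hu => simp only [map_smul, LinearMap.smul_apply, hu]
  | mem x hx =>
    obtain ⟨m, hm⟩ := hx
    induction hy using Submodule.span_induction with
    | zero => simp
    | add u v _ _ hu hv => simp only [map_add, LinearMap.add_apply, hu, hv]
    | smul t u _ hu => simp only [map_smul, LinearMap.smul_apply, hu]
    | mem y hy =>
      obtain ⟨n, hn⟩ := hy
      induction hz using Submodule.span_induction with
      | zero => simp
      | add u v _ _ hu hv => simp only [map_add, hu, hv]
      | smul t u _ hu => simp only [map_smul, hu]
      | mem z hz =>
        obtain ⟨k, hk⟩ := hz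
        exact sub_eq_zero.mp
          (artin_mono_assoc hleft hright a b c habc _ m n k x y z hm hn hk rfl)
end

section
/- (Power-associativity) Let A be an alternative algebra over a field K of characteristic 0. Then A is power-associative: for any element a ∈ A, the (non-unital) subalgebra of A generated by {a} is associative, i.e. (xy)z = x(yz) for all x, y, z in this subalgebra. -/
/-- The associator of the bilinear multiplication `μ`. -/
def assocr {K A : Type*} [Field K] [AddCommGroup A] [Module K A]
    (μ : A →ₗ[K] A →ₗ[K] A) (x y z : A) : A := μ (μ x y) z - μ x (μ y z)

/-- Left powers: `lpow μ a n` is the `(n+1)`-st left power of `a`. -/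
def lpow {K A : Type*} [Field K] [AddCommGroup A] [Module K A]
    (μ : A →ₗ[K] A →ₗ[K] A) (a : A) : ℕ → A
  | 0 => a
  | n + 1 => μ a (lpow μ a n)

section helpers
variable {K A : Type*} [Field K] [AddCommGroup A] [Module K A] (μ : A →ₗ[K] A →ₗ[K] A)

/-- The Teichmüller identity. -/
theorem teich (w x y z : A) :
    assocr μ (μ w x) y z - assocr μ w (μ x y) z + assocr μ w x (μ y z)
      = μ w (assocr μ x y z) + μ (assocr μ w x y) z := by
  simp only [assocr, map_sub, LinearMap.sub_apply]
  abel

theorem assocr_swap12 (hleft : ∀ x y : A, μ x (μ x y) = μ (μ x x) y) (x y z : A) :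
    assocr μ x y z = - assocr μ y x z := by
  have h := hleft (x + y) z
  simp only [map_add, LinearMap.add_apply, hleft] at h
  rw [← sub_eq_zero] at h ⊢
  rw [← neg_eq_zero, ← h]
  simp only [assocr]
  abel

theorem assocr_swap23 (hright : ∀ x y : A, μ (μ x y) y = μ x (μ y y)) (x y z : A) :
    assocr μ x y z = - assocr μ x z y := by
  have h := hright x (y + z)
  simp only [map_add, LinearMap.add_apply, hright] at h
  rw [← sub_eq_zero] at h ⊢
  rw [← h]
  simp only [assocr]
  abel

theorem assocr_step [CharZero K] (hleft : ∀ x y : A, μ x (μ x y) = μ (μ x x) y)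
    (hright : ∀ x y : A, μ (μ x y) y = μ x (μ y y)) (a y : A)
    (h : ∀ x, assocr μ a y x = 0) (x : A) : assocr μ a (μ a y) x = 0 := by
  have h' : ∀ x, assocr μ y a x = 0 := fun x => by
    rw [assocr_swap12 μ hleft, h, neg_zero]
  have haa : ∀ x, assocr μ a a x = 0 := fun x => by simp [assocr, hleft]
  have haa' : ∀ x, assocr μ x a a = 0 := fun x => by simp [assocr, hright]
  have t1 := teich μ a a y x
  have t2 := teich μ a y a x
  have t3 := teich μ y a a x
  simp only [h, h', haa, haa', map_zero, LinearMap.zero_apply, add_zero, sub_eq_zero] at t1 t2 t3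
  rw [assocr_swap12 μ hleft (μ a y)] at t2
  rw [assocr_swap12 μ hleft (μ y a), assocr_swap12 μ hleft y, neg_inj] at t3
  rw [← t2, t1] at t3
  have h2 : (2 : K) • assocr μ a (μ a y) x = 0 := by
    rw [two_smul]
    nth_rewrite 1 [← t3]
    exact neg_add_cancel _
  exact (smul_eq_zero.mp h2).resolve_left two_ne_zero

theorem assocr_lpow [CharZero K] (hleft : ∀ x y : A, μ x (μ x y) = μ (μ x x) y)
    (hright : ∀ x y : A, μ (μ x y) y = μ x (μ y y)) (a : A) (n : ℕ) :
    ∀ x, assocr μ a (lpow μ a n) x = 0 := by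
  induction n with
  | zero => intro x; simp [assocr, lpow, hleft]
  | succ n ih => exact assocr_step μ hleft hright a _ ih

theorem lpow_mul [CharZero K] (hleft : ∀ x y : A, μ x (μ x y) = μ (μ x x) y)
    (hright : ∀ x y : A, μ (μ x y) y = μ x (μ y y)) (a : A) (i j : ℕ) :
    μ (lpow μ a i) (lpow μ a j) = lpow μ a (i + j + 1) := by
  induction i with
  | zero => rw [Nat.zero_add]; rfl
  | succ i ih =>
    have h := sub_eq_zero.mp (assocr_lpow μ hleft hright a i (lpow μ a j))
    rw [ih] at h
    rw [show i + 1 + j + 1 = (i + j + 1) + 1 by omega]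
    exact h

theorem gen_subset_span [CharZero K] (hleft : ∀ x y : A, μ x (μ x y) = μ (μ x x) y)
    (hright : ∀ x y : A, μ (μ x y) y = μ x (μ y y)) (a : A) :
    genSubalgebra μ {a} ⊆ (Submodule.span K (Set.range (lpow μ a)) : Set A) := by
  apply Set.sInter_subset_of_mem
  refine ⟨?_, ⟨_, rfl⟩, ?_⟩
  · rintro _ rfl
    exact Submodule.subset_span ⟨0, rfl⟩
  · intro x hx y hy
    simp only [SetLike.mem_coe] at hx hy ⊢
    induction hx, hy using Submodule.span_induction₂ with
    | mem_mem x y hx hy =>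
      obtain ⟨i, rfl⟩ := hx
      obtain ⟨j, rfl⟩ := hy
      exact Submodule.subset_span ⟨_, (lpow_mul μ hleft hright a i j).symm⟩
    | zero_left => simp
    | zero_right => simp
    | add_left x y z _ _ _ h1 h2 => simpa using add_mem h1 h2
    | add_right x y z _ _ _ h1 h2 => simpa using add_mem h1 h2
    | smul_left r x y _ _ h => simpa using Submodule.smul_mem _ r h
    | smul_right r x y _ _ h => simpa using Submodule.smul_mem _ r h

end helpers

/-- Power-associativity of alternative algebras: the subalgebra generated by
a single element is associative. -/
theorem alternative_powerAssociative
    {K A : Type*} [Field K] [CharZero K] [AddCommGroup A] [Module K A]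
    (μ : A →ₗ[K] A →ₗ[K] A)
    (hleft : ∀ x y : A, μ x (μ x y) = μ (μ x x) y)
    (hright : ∀ x y : A, μ (μ x y) y = μ x (μ y y))
    (a : A) :
    ∀ x ∈ genSubalgebra μ {a}, ∀ y ∈ genSubalgebra μ {a},
      ∀ z ∈ genSubalgebra μ {a}, μ (μ x y) z = μ x (μ y z) := by
  intro x hx y hy z hz
  replace hx := gen_subset_span μ hleft hright a hx
  replace hy := gen_subset_span μ hleft hright a hy
  replace hz := gen_subset_span μ hleft hright a hz
  simp only [SetLike.mem_coe] at hx hy hz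
  induction hx, hy using Submodule.span_induction₂ with
  | mem_mem x y hx hy =>
    obtain ⟨i, rfl⟩ := hx
    obtain ⟨j, rfl⟩ := hy
    induction hz using Submodule.span_induction with
    | mem z hz =>
      obtain ⟨k, rfl⟩ := hz
      simp only [lpow_mul μ hleft hright]
      congr 1
      omega
    | zero => simp
    | add x y _ _ h1 h2 => simp [h1, h2]
    | smul r x _ h => simp [h]
  | zero_left => simp
  | zero_right => simp
  | add_left x y z _ _ _ h1 h2 => simp [h1, h2]
  | add_right x y z _ _ _ h1 h2 => simp [h1, h2]
  | smul_left r x y _ _ h => simp [h]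
  | smul_right r x y _ _ h => simp [h]
end

section
/- Let A be a left Moufang algebra over a field K of characteristic 0, i.e. a K-vector space with bilinear multiplication μ satisfying the left alternative identity μ(x, μ(x,y)) = μ(μ(x,x), y) and the Moufang identity μ(μ(x,y), μ(z,x)) = μ(μ(x, μ(y,z)), x) for all x, y, z ∈ A. Then A is alternative (i.e. additionally satisfies μ(μ(x,y), y) = μ(x, μ(y,y)) for all x, y) if and only if A is flexible, i.e. μ(μ(x,y), x) = μ(x, μ(y,x)) for all x, y ∈ A. -/
/-- A left Moufang algebra is alternative if and only if it is flexible. -/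
theorem leftMoufang_alternative_iff_flexible
    {K A : Type*} [Field K] [CharZero K] [AddCommGroup A] [Module K A]
    (μ : A →ₗ[K] A →ₗ[K] A)
    (hleft : ∀ x y : A, μ x (μ x y) = μ (μ x x) y)
    (hmoufang : ∀ x y z : A, μ (μ x y) (μ z x) = μ (μ x (μ y z)) x) :
    (∀ x y : A, μ (μ x y) y = μ x (μ y y)) ↔
    (∀ x y : A, μ (μ x y) x = μ x (μ y x)) := by
  constructor
  · intro h x y
    have h1 := h x (x + y)
    have h2 := h x x
    have h3 := h x y
    have h4 := hleft x y
    simp only [map_add, LinearMap.add_apply] at h1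
    rw [h2, h3, h4] at h1
    have h5 : μ (μ x y) x - μ x (μ y x) = 0 := by
      rw [← sub_eq_zero] at h1
      rw [← h1]
      abel
    exact sub_eq_zero.mp h5
  · intro h x y
    have h1 := hleft (x + y) y
    have h2 := hleft x y
    have h3 := hleft y y
    have h4 := h y x
    simp only [map_add, LinearMap.add_apply] at h1
    rw [h2, h3, ← h4] at h1
    have h5 : μ x (μ y y) - μ (μ x y) y = 0 := by
      rw [← sub_eq_zero] at h1
      rw [← h1]
      abel
    exact (sub_eq_zero.mp h5).symm
end

section
/- Let (A, μ) be a left alternative algebra over a field K of characteristic 0. Then δ² ∘ δ¹ = 0: for every linear map f: A → A, the trilinear map δ²(δ¹f) vanishes identically, i.e. δ²(δ¹f)(x,y,z) = 0 for all x, y, z ∈ A. -/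
/-- The first differential of a linear map. -/
def d1 {K A : Type*} [Field K] [AddCommGroup A] [Module K A]
    (μ : A →ₗ[K] A →ₗ[K] A) (f : A →ₗ[K] A) : A → A → A :=
  fun x y => μ (f x) y + μ x (f y) - f (μ x y)

/-- The second differential of a bilinear map (given as a function). -/
def d2 {K A : Type*} [Field K] [AddCommGroup A] [Module K A]
    (μ : A →ₗ[K] A →ₗ[K] A) (φ : A → A → A) : A → A → A → A :=
  fun x y z =>
    μ (φ x y) z - μ x (φ y z) + φ (μ x y) z - φ x (μ y z) +
    μ (φ y x) z - μ y (φ x z) + φ (μ y x) z - φ y (μ x z)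

/-- For a left alternative algebra, `δ² ∘ δ¹ = 0`. -/
theorem d2_comp_d1_eq_zero
    {K A : Type*} [Field K] [CharZero K] [AddCommGroup A] [Module K A]
    (μ : A →ₗ[K] A →ₗ[K] A)
    (hleft : ∀ x y : A, μ x (μ x y) = μ (μ x x) y)
    (f : A →ₗ[K] A) :
    ∀ x y z : A, d2 μ (d1 μ f) x y z = 0 := by
  have S : ∀ x y z : A, μ (μ x y) z + μ (μ y x) z - μ x (μ y z) - μ y (μ x z) = 0 := by
    intro x y z
    have h := hleft (x + y) z
    simp only [map_add, LinearMap.add_apply, hleft x z, hleft y z] at h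
    have h' := sub_eq_zero.mpr h
    rw [← neg_eq_zero, ← h']
    abel
  intro x y z
  have h1 := S (f x) y z
  have h2 := S x (f y) z
  have h3 := S x y (f z)
  have h4 := congrArg f (S x y z)
  simp only [map_add, map_sub, map_zero] at h4
  simp only [d2, d1, map_add, map_sub, LinearMap.add_apply, LinearMap.sub_apply]
  have h5 : (0 : A) = 0 + 0 + 0 - 0 := by simp
  rw [h5]
  nth_rewrite 1 [← h1]
  nth_rewrite 1 [← h2]
  nth_rewrite 1 [← h3]
  rw [← h4]
  abel
end

section
/- (Integrability of μ₁ depends only on its cohomology class) Let (A, μ₀) be a left alternative algebra over a field K of characteristic 0, let (μ_i)_{i≥0} be a formal left alternative deformation of (A, μ₀), and let f: A → A be a linear map. Then there exists a formal left alternative deformation (μ'_i)_{i≥0} of (A, μ₀) with μ'₀ = μ₀ and μ'₁ = μ₁ − δ¹f; in particular, if a 2-cocycle is integrable, then so is every 2-cocycle cohomologous to it. -/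
/-- The order-`k` deformation equation for a sequence of bilinear maps. -/
def DeformEq {K A : Type*} [Field K] [AddCommGroup A] [Module K A]
    (μ : ℕ → (A →ₗ[K] A →ₗ[K] A)) (k : ℕ) : Prop :=
  ∀ x y z : A,
    ∑ i ∈ Finset.range (k + 1),
      (μ i x (μ (k - i) y z) - μ i (μ (k - i) x y) z +
        μ i y (μ (k - i) x z) - μ i (μ (k - i) y x) z) = 0

section Helpers
variable {K A : Type*} [Field K] [AddCommGroup A] [Module K A]

/-- Multiplication by the formal parameter. -/
def shiftSeq {K V : Type*} [Field K] [AddCommGroup V] [Module K V] :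
    (ℕ → V) →ₗ[K] (ℕ → V) where
  toFun a := fun k => Nat.casesOn k 0 a
  map_add' a b := by ext k; cases k <;> simp
  map_smul' c a := by ext k; cases k <;> simp

@[simp] lemma shiftSeq_zero {V : Type*} [AddCommGroup V] [Module K V] (a : ℕ → V) :
    shiftSeq (K := K) a 0 = 0 := rfl
@[simp] lemma shiftSeq_succ {V : Type*} [AddCommGroup V] [Module K V] (a : ℕ → V) (k : ℕ) :
    shiftSeq (K := K) a (k + 1) = a k := rfl

/-- Cauchy product of a series of endomorphisms with a series of vectors. -/
def convSeq : (ℕ → (A →ₗ[K] A)) →ₗ[K] (ℕ → A) →ₗ[K] (ℕ → A) :=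
  LinearMap.mk₂ K (fun g b k => ∑ p ∈ Finset.HasAntidiagonal.antidiagonal k, g p.1 (b p.2))
    (by intros; ext k; simp [Finset.sum_add_distrib])
    (by intros; ext k; simp [Finset.smul_sum])
    (by intros; ext k; simp [Finset.sum_add_distrib])
    (by intros; ext k; simp [Finset.smul_sum])

lemma convSeq_apply (g : ℕ → (A →ₗ[K] A)) (b : ℕ → A) (k : ℕ) :
    convSeq g b k = ∑ p ∈ Finset.HasAntidiagonal.antidiagonal k, g p.1 (b p.2) := rfl

lemma convSeq_shift_left (g : ℕ → (A →ₗ[K] A)) (b : ℕ → A) :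
    convSeq (shiftSeq (K := K) g) b = shiftSeq (K := K) (convSeq g b) := by
  ext k
  cases k with
  | zero => simp [convSeq_apply]
  | succ k => simp [convSeq_apply, Finset.Nat.sum_antidiagonal_succ]

lemma convSeq_shift_right (g : ℕ → (A →ₗ[K] A)) (b : ℕ → A) :
    convSeq g (shiftSeq (K := K) b) = shiftSeq (K := K) (convSeq g b) := by
  ext k
  cases k with
  | zero => simp [convSeq_apply]
  | succ k => simp [convSeq_apply, Finset.Nat.sum_antidiagonal_succ']

/-- Coefficientwise application of `f`. -/
def mapSeq (f : A →ₗ[K] A) : (ℕ → A) →ₗ[K] (ℕ → A) := f.compLeft ℕ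

@[simp] lemma mapSeq_apply (f : A →ₗ[K] A) (a : ℕ → A) (k : ℕ) : mapSeq f a k = f (a k) := rfl

lemma convSeq_comp_left (f : A →ₗ[K] A) (g : ℕ → (A →ₗ[K] A)) (b : ℕ → A) :
    convSeq (fun i => f ∘ₗ g i) b = mapSeq f (convSeq g b) := by
  ext k; simp [convSeq_apply]

lemma convSeq_comp_right (f : A →ₗ[K] A) (g : ℕ → (A →ₗ[K] A)) (b : ℕ → A) :
    convSeq (fun i => g i ∘ₗ f) b = convSeq g (mapSeq f b) := by
  ext k; simp [convSeq_apply]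

lemma eq_zero_of_shift (f : A →ₗ[K] A) (v : ℕ → A)
    (h : v - shiftSeq (K := K) (mapSeq f v) = 0) : v = 0 := by
  ext k
  induction k with
  | zero => simpa using congrFun h 0
  | succ k ih =>
    have := congrFun h (k + 1)
    simpa [ih] using this

/-- Key computation. -/
lemma convSeq_key (f : A →ₗ[K] A) (G' J : ℕ → (A →ₗ[K] A)) (b' c : ℕ → A)
    (hG : G' = shiftSeq (K := K) (fun i => f ∘ₗ G' i) + J
      - shiftSeq (K := K) (fun i => J i ∘ₗ f))
    (hb : b' - shiftSeq (K := K) (mapSeq f b') = c) :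
    convSeq G' b' - shiftSeq (K := K) (mapSeq f (convSeq G' b')) = convSeq J c := by
  have h1 : convSeq G' b' = convSeq (shiftSeq (K := K) (fun i => f ∘ₗ G' i) + J
      - shiftSeq (K := K) (fun i => J i ∘ₗ f)) b' := congrArg (fun g => convSeq g b') hG
  simp only [map_add, map_sub, LinearMap.add_apply, LinearMap.sub_apply, convSeq_shift_left,
    convSeq_comp_left, convSeq_comp_right] at h1
  rw [← hb, map_sub, convSeq_shift_right, sub_eq_iff_eq_add]
  refine h1.trans ?_
  abel

/-- The defect of left alternativity as a series. -/
def defect (μ : ℕ → (A →ₗ[K] A →ₗ[K] A)) (x y z : A) : ℕ → A :=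
  convSeq (fun i => μ i x) (fun i => μ i y z) - convSeq (fun i => (μ i).flip z) (fun i => μ i x y)
  + convSeq (fun i => μ i y) (fun i => μ i x z)
  - convSeq (fun i => (μ i).flip z) (fun i => μ i y x)

lemma deformEq_iff (μ : ℕ → (A →ₗ[K] A →ₗ[K] A)) (k : ℕ) :
    DeformEq μ k ↔ ∀ x y z, defect μ x y z k = 0 := by
  unfold DeformEq
  refine forall_congr' fun x => forall_congr' fun y => forall_congr' fun z => ?_
  rw [← Finset.Nat.sum_antidiagonal_eq_sum_range_succ (fun i j =>
    μ i x (μ j y z) - μ i (μ j x y) z + μ i y (μ j x z) - μ i (μ j y x) z)]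
  simp [defect, convSeq_apply, Finset.sum_add_distrib, Finset.sum_sub_distrib]

/-- The conjugated multiplication: `(1 - t f) μ' (x, y) = μ ((1 - t f) x, (1 - t f) y)`. -/
def twistAux (μ : ℕ → (A →ₗ[K] A →ₗ[K] A)) (f : A →ₗ[K] A) : ℕ → (A →ₗ[K] A →ₗ[K] A) :=
  μ - shiftSeq (K := K) (fun i => (μ i).comp f) - shiftSeq (K := K) (fun i => (μ i).compl₂ f)
    + shiftSeq (K := K) (shiftSeq (K := K) (fun i => (μ i).compl₁₂ f f))

/-- The twisted deformation. -/
def twist (μ : ℕ → (A →ₗ[K] A →ₗ[K] A)) (f : A →ₗ[K] A) : ℕ → (A →ₗ[K] A →ₗ[K] A)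
  | 0 => twistAux μ f 0
  | k + 1 => twistAux μ f (k + 1) + (twist μ f k).compr₂ f

lemma twist_left (μ : ℕ → (A →ₗ[K] A →ₗ[K] A)) (f : A →ₗ[K] A) (x : A) :
    (fun i => twist μ f i x) = shiftSeq (K := K) (fun i => f ∘ₗ twist μ f i x)
      + ((fun i => μ i x) - shiftSeq (K := K) (fun i => μ i (f x)))
      - shiftSeq (K := K) (fun i =>
        ((fun i => μ i x) - shiftSeq (K := K) (fun i => μ i (f x))) i ∘ₗ f) := by
  ext k y
  rcases k with _ | _ | k <;> simp [twist, twistAux] <;> abel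

lemma twist_right (μ : ℕ → (A →ₗ[K] A →ₗ[K] A)) (f : A →ₗ[K] A) (x : A) :
    (fun i => (twist μ f i).flip x) = shiftSeq (K := K) (fun i => f ∘ₗ (twist μ f i).flip x)
      + ((fun i => (μ i).flip x) - shiftSeq (K := K) (fun i => (μ i).flip (f x)))
      - shiftSeq (K := K) (fun i =>
        ((fun i => (μ i).flip x) - shiftSeq (K := K) (fun i => (μ i).flip (f x))) i ∘ₗ f) := by
  ext k y
  rcases k with _ | _ | k <;> simp [twist, twistAux] <;> abel

lemma twist_val (μ : ℕ → (A →ₗ[K] A →ₗ[K] A)) (f : A →ₗ[K] A) (x y : A) :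
    (fun i => twist μ f i x y) - shiftSeq (K := K) (mapSeq f (fun i => twist μ f i x y)) =
      (fun i => μ i x y) - shiftSeq (K := K) (fun i => μ i (f x) y)
      - shiftSeq (K := K) (fun i => μ i x (f y))
      + shiftSeq (K := K) (shiftSeq (K := K) (fun i => μ i (f x) (f y))) := by
  ext k
  rcases k with _ | _ | k <;> simp [twist, twistAux]

lemma defect_twist (μ : ℕ → (A →ₗ[K] A →ₗ[K] A)) (f : A →ₗ[K] A)
    (h : ∀ x y z, defect μ x y z = 0) (x y z : A) : defect (twist μ f) x y z = 0 := by
  apply eq_zero_of_shift f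
  have e1 := convSeq_key f _ _ _ _ (twist_left μ f x) (twist_val μ f y z)
  have e2 := convSeq_key f _ _ _ _ (twist_right μ f z) (twist_val μ f x y)
  have e3 := convSeq_key f _ _ _ _ (twist_left μ f y) (twist_val μ f x z)
  have e4 := convSeq_key f _ _ _ _ (twist_right μ f z) (twist_val μ f y x)
  have e : defect (twist μ f) x y z - shiftSeq (K := K) (mapSeq f (defect (twist μ f) x y z)) =
      defect μ x y z
      - shiftSeq (K := K) (defect μ (f x) y z + defect μ x (f y) z + defect μ x y (f z))
      + shiftSeq (K := K) (shiftSeq (K := K)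
        (defect μ (f x) (f y) z + defect μ x (f y) (f z) + defect μ (f x) y (f z)))
      - shiftSeq (K := K) (shiftSeq (K := K) (shiftSeq (K := K)
        (defect μ (f x) (f y) (f z)))) := by
    simp only [map_add, map_sub, LinearMap.sub_apply, convSeq_shift_left,
      convSeq_shift_right] at e1 e2 e3 e4
    simp only [defect, map_add, map_sub]
    have e5 := congrArg₂ (· - ·) (congrArg₂ (· + ·) (congrArg₂ (· - ·) e1 e2) e3) e4
    refine Eq.trans ?_ (e5.trans ?_) <;> beta_reduce <;> abel
  rw [e]
  simp [h]

end Helpers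

/-- Integrability of the infinitesimal depends only on its cohomology
class: subtracting a coboundary from `μ₁` again yields the infinitesimal of
a formal left alternative deformation. -/
theorem integrability_depends_on_cohomology_class
    {K A : Type*} [Field K] [CharZero K] [AddCommGroup A] [Module K A]
    (μ : ℕ → (A →ₗ[K] A →ₗ[K] A))
    (hleft : ∀ x y : A, μ 0 x (μ 0 x y) = μ 0 (μ 0 x x) y)
    (hdef : ∀ k : ℕ, DeformEq μ k)
    (f : A →ₗ[K] A) :
    ∃ μ' : ℕ → (A →ₗ[K] A →ₗ[K] A),
      (∀ k : ℕ, DeformEq μ' k) ∧ μ' 0 = μ 0 ∧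
      (∀ x y : A, μ' 1 x y = μ 1 x y - d1 (μ 0) f x y) := by
  refine ⟨twist μ f, fun k => (deformEq_iff _ k).2 fun x y z => ?_, ?_, fun x y => ?_⟩
  · rw [defect_twist μ f (fun x y z => funext fun k => (deformEq_iff μ k).1 (hdef k) x y z)]
    rfl
  · ext x y
    simp [twist, twistAux]
  · simp [twist, twistAux, d1]
    abel
end

section
/- Let (A, μ₀) be a left alternative algebra over a field K of characteristic 0 and let (μ_i)_{i≥0} be a formal left alternative deformation of (A, μ₀) such that μ₁ = ⋯ = μ_{m−1} = 0 (m ≥ 1) and μ_m = δ¹g for some linear map g: A → A. Then (μ_i) is equivalent to a formal left alternative deformation whose coefficients in degrees 1 through m vanish: there exist a formal left alternative deformation (μ'_i)_{i≥0} of (A, μ₀) with μ'₀ = μ₀ and μ'₁ = ⋯ = μ'_m = 0, and a sequence of linear maps Φ_i: A → A with Φ₀ = id, such that for every k ≥ 0 and all x, y ∈ A, Σ_{i+j=k} Φ_i(μ'_j(x,y)) = Σ_{i+j+l=k} μ_i(Φ_j(x), Φ_l(y)). -/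
section Helpers
variable {K A : Type*} [Field K] [AddCommGroup A] [Module K A]

/-- multiplication by the formal parameter -/
def tau : (ℕ → A) →ₗ[K] (ℕ → A) where
  toFun a k := match k with
    | 0 => 0
    | k + 1 => a k
  map_add' a b := by ext k; cases k <;> simp
  map_smul' c a := by ext k; cases k <;> simp

@[simp] lemma tau_zero (a : ℕ → A) : tau (K := K) a 0 = 0 := rfl
@[simp] lemma tau_succ (a : ℕ → A) (k : ℕ) : tau (K := K) a (k + 1) = a k := rfl

lemma tau_iter (m : ℕ) (a : ℕ → A) (k : ℕ) :
    ((tau (K := K) (A := A)) ^ m) a k = if m ≤ k then a (k - m) else 0 := by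
  induction m generalizing k with
  | zero => simp
  | succ m ih =>
    rw [pow_succ', Module.End.mul_apply]
    cases k with
    | zero => simp
    | succ k => simp [ih]

/-- constant series -/
def cst (x : A) : ℕ → A := fun k => if k = 0 then x else 0

lemma decomp (a : ℕ → A) : a = cst (a 0) + tau (K := K) (fun n => a (n + 1)) := by
  ext k; cases k <;> simp [cst]

/-- extension of a sequence of bilinear maps to series -/
def ext2 (μ : ℕ → (A →ₗ[K] A →ₗ[K] A)) (a b : ℕ → A) : ℕ → A := fun k =>
  ∑ p ∈ Finset.HasAntidiagonal.antidiagonal k, ∑ q ∈ Finset.HasAntidiagonal.antidiagonal p.2, μ p.1 (a q.1) (b q.2)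

variable (μ : ℕ → (A →ₗ[K] A →ₗ[K] A))

lemma ext2_add_left (a a' b : ℕ → A) : ext2 μ (a + a') b = ext2 μ a b + ext2 μ a' b := by
  ext k; simp [ext2, Finset.sum_add_distrib]

lemma ext2_add_right (a b b' : ℕ → A) : ext2 μ a (b + b') = ext2 μ a b + ext2 μ a b' := by
  ext k; simp [ext2, Finset.sum_add_distrib]

lemma ext2_sub_left (a a' b : ℕ → A) : ext2 μ (a - a') b = ext2 μ a b - ext2 μ a' b := by
  ext k; simp [ext2, Finset.sum_sub_distrib]

lemma ext2_sub_right (a b b' : ℕ → A) : ext2 μ a (b - b') = ext2 μ a b - ext2 μ a b' := by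
  ext k; simp [ext2, Finset.sum_sub_distrib]

lemma ext2_tau_left (a b : ℕ → A) :
    ext2 μ (tau (K := K) a) b = tau (K := K) (ext2 μ a b) := by
  ext k
  cases k with
  | zero => simp [ext2]
  | succ k =>
    simp only [ext2, tau_succ]
    rw [Finset.Nat.sum_antidiagonal_succ']
    simp [Finset.Nat.sum_antidiagonal_succ]

lemma ext2_tau_right (a b : ℕ → A) :
    ext2 μ a (tau (K := K) b) = tau (K := K) (ext2 μ a b) := by
  ext k
  cases k with
  | zero => simp [ext2]
  | succ k =>
    simp only [ext2, tau_succ]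
    rw [Finset.Nat.sum_antidiagonal_succ']
    simp [Finset.Nat.sum_antidiagonal_succ']

lemma ext2_taum_left (m : ℕ) (a b : ℕ → A) :
    ext2 μ ((tau (K := K) ^ m) a) b = (tau (K := K) ^ m) (ext2 μ a b) := by
  induction m with
  | zero => simp
  | succ m ih => simp only [pow_succ', Module.End.mul_apply, ext2_tau_left, ih]

lemma ext2_taum_right (m : ℕ) (a b : ℕ → A) :
    ext2 μ a ((tau (K := K) ^ m) b) = (tau (K := K) ^ m) (ext2 μ a b) := by
  induction m with
  | zero => simp
  | succ m ih => simp only [pow_succ', Module.End.mul_apply, ext2_tau_right, ih]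

lemma ext2_cst_left (x : A) (b : ℕ → A) (k : ℕ) :
    ext2 μ (cst x) b k = ∑ i ∈ Finset.range (k + 1), μ i x (b (k - i)) := by
  rw [← Finset.Nat.sum_antidiagonal_eq_sum_range_succ (fun i j => μ i x (b j))]
  refine Finset.sum_congr rfl fun p _ => ?_
  cases h : p.2 with
  | zero => simp [cst]
  | succ n => simp [Finset.Nat.sum_antidiagonal_succ, cst]

lemma ext2_cst_right (a : ℕ → A) (y : A) (k : ℕ) :
    ext2 μ a (cst y) k = ∑ i ∈ Finset.range (k + 1), μ i (a (k - i)) y := by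
  rw [← Finset.Nat.sum_antidiagonal_eq_sum_range_succ (fun i j => μ i (a j) y)]
  refine Finset.sum_congr rfl fun p _ => ?_
  cases h : p.2 with
  | zero => simp [cst]
  | succ n => simp [Finset.Nat.sum_antidiagonal_succ', cst]

lemma ext2_cst_cst (x y : A) : ext2 μ (cst x) (cst y) = fun k => μ k x y := by
  ext k
  rw [ext2_cst_left, Finset.sum_range_succ, Finset.sum_eq_zero]
  · simp [cst]
  · intro i hi
    have : k - i ≠ 0 := by have := Finset.mem_range.1 hi; omega
    simp [cst, this]

lemma bil_zero (T : (ℕ → A) → (ℕ → A) → (ℕ → A))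
    (h1 : ∀ a a' b, T (a + a') b = T a b + T a' b)
    (h2 : ∀ a b b', T a (b + b') = T a b + T a b')
    (t1 : ∀ a b, T (tau (K := K) a) b = tau (K := K) (T a b))
    (t2 : ∀ a b, T a (tau (K := K) b) = tau (K := K) (T a b))
    (h0 : ∀ x y, T (cst x) (cst y) = 0) (a b) : T a b = 0 := by
  ext k
  induction k generalizing a b with
  | zero => rw [decomp (K := K) a, decomp (K := K) b]; simp [h1, h2, t1, t2, h0]
  | succ k ih =>
    rw [decomp (K := K) a, decomp (K := K) b]
    simp only [h1, h2, Pi.add_apply]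
    simp only [t1, h0, tau_succ, ih]
    simp only [t2, tau_succ, ih]
    simp

lemma tri_zero (T : (ℕ → A) → (ℕ → A) → (ℕ → A) → (ℕ → A))
    (h1 : ∀ a a' b c, T (a + a') b c = T a b c + T a' b c)
    (h2 : ∀ a b b' c, T a (b + b') c = T a b c + T a b' c)
    (h3 : ∀ a b c c', T a b (c + c') = T a b c + T a b c')
    (t1 : ∀ a b c, T (tau (K := K) a) b c = tau (K := K) (T a b c))
    (t2 : ∀ a b c, T a (tau (K := K) b) c = tau (K := K) (T a b c))
    (t3 : ∀ a b c, T a b (tau (K := K) c) = tau (K := K) (T a b c))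
    (h0 : ∀ x y z, T (cst x) (cst y) (cst z) = 0) (a b c) : T a b c = 0 := by
  ext k
  induction k generalizing a b c with
  | zero =>
    rw [decomp (K := K) a, decomp (K := K) b, decomp (K := K) c]
    simp [h1, h2, h3, t1, t2, t3, h0]
  | succ k ih =>
    rw [decomp (K := K) a, decomp (K := K) b, decomp (K := K) c]
    simp only [h1, h2, h3, Pi.add_apply]
    simp only [t1, h0, tau_succ, ih]
    simp only [t2, tau_succ, ih]
    simp only [t3, tau_succ, ih]
    simp

/-- the left alternator -/
def alt3 (a b c : ℕ → A) : ℕ → A :=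
  ext2 μ a (ext2 μ b c) - ext2 μ (ext2 μ a b) c + ext2 μ b (ext2 μ a c) - ext2 μ (ext2 μ b a) c

lemma alt3_cst (x y z : A) (k : ℕ) : alt3 μ (cst x) (cst y) (cst z) k =
    ∑ i ∈ Finset.range (k + 1),
      (μ i x (μ (k - i) y z) - μ i (μ (k - i) x y) z +
        μ i y (μ (k - i) x z) - μ i (μ (k - i) y x) z) := by
  simp only [alt3, ext2_cst_cst, Pi.sub_apply, Pi.add_apply, ext2_cst_left, ext2_cst_right,
    Finset.sum_add_distrib, Finset.sum_sub_distrib]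

lemma alt3_zero (h : ∀ k, DeformEq μ k) (a b c : ℕ → A) : alt3 μ a b c = 0 := by
  apply tri_zero (K := K) (alt3 μ)
  · intros; simp only [alt3, ext2_add_left, ext2_add_right]; abel
  · intros; simp only [alt3, ext2_add_left, ext2_add_right]; abel
  · intros; simp only [alt3, ext2_add_left, ext2_add_right]; abel
  · intros; simp only [alt3, ext2_tau_left, ext2_tau_right, map_add, map_sub]
  · intros; simp only [alt3, ext2_tau_left, ext2_tau_right, map_add, map_sub]
  · intros; simp only [alt3, ext2_tau_left, ext2_tau_right, map_add, map_sub]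
  · intro x y z; ext k; rw [alt3_cst]; exact h k x y z

/-- the gauge transformation `1 - t^m g` on series -/
def gau (m : ℕ) (g : A →ₗ[K] A) : (ℕ → A) →ₗ[K] (ℕ → A) :=
  LinearMap.id - (tau (K := K) ^ m) ∘ₗ g.compLeft ℕ

lemma gau_apply (m : ℕ) (g : A →ₗ[K] A) (a : ℕ → A) (k : ℕ) :
    gau m g a k = a k - if m ≤ k then g (a (k - m)) else 0 := by
  simp [gau, tau_iter]

lemma gau_tau (m : ℕ) (g : A →ₗ[K] A) (a : ℕ → A) :
    gau m g (tau (K := K) a) = tau (K := K) (gau m g a) := by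
  have : g.compLeft ℕ (tau (K := K) a) = tau (K := K) (g.compLeft ℕ a) := by
    ext k; cases k <;> simp
  simp only [gau, LinearMap.sub_apply, LinearMap.id_apply, LinearMap.comp_apply, this, map_sub]
  congr 1
  exact LinearMap.congr_fun ((pow_succ (tau (K := K) (A := A)) m).symm.trans (pow_succ' _ m))
    (g.compLeft ℕ a)

lemma gau_inj (m : ℕ) (hm : 1 ≤ m) (g : A →ₗ[K] A) (a : ℕ → A) (h : gau m g a = 0) : a = 0 := by
  ext k
  induction k using Nat.strong_induction_on with
  | _ k ih =>
    have := congrFun h k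
    rw [gau_apply] at this
    by_cases hk : m ≤ k
    · rw [ih (k - m) (by omega)] at this
      simpa using this
    · simpa [hk] using this

lemma gau_cst (m : ℕ) (g : A →ₗ[K] A) (x : A) :
    gau m g (cst x) = cst x - (tau (K := K) ^ m) (cst (g x)) := by
  have : g.compLeft ℕ (cst x) = cst (g x) := by
    ext k; by_cases hk : k = 0 <;> simp [cst, hk]
  simp [gau, this]

/-- the coefficients of the gauge transformation -/
def phi (m : ℕ) (g : A →ₗ[K] A) (i : ℕ) : A →ₗ[K] A :=
  (if i = 0 then LinearMap.id else 0) - (if i = m then g else 0)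

lemma phi_apply (m : ℕ) (g : A →ₗ[K] A) (i : ℕ) (x : A) :
    phi m g i x = (if i = 0 then x else 0) - (if i = m then g x else 0) := by
  unfold phi; split_ifs <;> simp

lemma phi_cst (m : ℕ) (g : A →ₗ[K] A) (i : ℕ) (x : A) :
    phi m g i x = gau m g (cst x) i := by
  rw [phi_apply, gau_cst, Pi.sub_apply, tau_iter]
  congr 1
  by_cases h : i = m
  · simp [h, cst]
  · by_cases h' : m ≤ i
    · have : i - m ≠ 0 := by omega
      simp [h, cst, this]
    · simp [h, h']

lemma phi_sum (m : ℕ) (g : A →ₗ[K] A) (a : ℕ → A) (k : ℕ) :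
    ∑ i ∈ Finset.range (k + 1), phi m g i (a (k - i)) = gau m g a k := by
  simp only [phi_apply, gau_apply, Finset.sum_sub_distrib, Finset.sum_ite_eq', Finset.mem_range]
  simp [Nat.lt_succ_iff]

/-- right-hand side coefficients -/
noncomputable def nuu (m : ℕ) (g : A →ₗ[K] A) (k : ℕ) : A →ₗ[K] A →ₗ[K] A :=
  ∑ p ∈ Finset.HasAntidiagonal.antidiagonal k, ∑ q ∈ Finset.HasAntidiagonal.antidiagonal p.2,
    (μ p.1).compl₁₂ (phi m g q.1) (phi m g q.2)

lemma nuu_apply (m : ℕ) (g : A →ₗ[K] A) (k : ℕ) (x y : A) :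
    nuu μ m g k x y = ext2 μ (gau m g (cst x)) (gau m g (cst y)) k := by
  simp [nuu, ext2, LinearMap.sum_apply, phi_cst]

/-- the new deformation -/
noncomputable def newMu (m : ℕ) (g : A →ₗ[K] A) (k : ℕ) : A →ₗ[K] A →ₗ[K] A :=
  nuu μ m g k + if _h : 1 ≤ m ∧ m ≤ k then (newMu m g (k - m)).compr₂ g else 0
termination_by k

lemma gau_newMu (m : ℕ) (hm : 1 ≤ m) (g : A →ₗ[K] A) (x y : A) :
    gau m g (fun k => newMu μ m g k x y) = ext2 μ (gau m g (cst x)) (gau m g (cst y)) := by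
  ext k
  rw [gau_apply, ← nuu_apply, newMu]
  by_cases h : m ≤ k <;> simp [h, hm]

lemma gau_ext2 (m : ℕ) (hm : 1 ≤ m) (g : A →ₗ[K] A) (a b : ℕ → A) :
    gau m g (ext2 (newMu μ m g) a b) = ext2 μ (gau m g a) (gau m g b) := by
  rw [← sub_eq_zero]
  apply bil_zero (K := K)
    (fun a b => gau m g (ext2 (newMu μ m g) a b) - ext2 μ (gau m g a) (gau m g b))
  · intros; simp only [ext2_add_left, map_add]; abel
  · intros; simp only [ext2_add_right, map_add]; abel
  · intros; simp only [ext2_tau_left, gau_tau, map_sub]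
  · intros; simp only [ext2_tau_right, gau_tau, map_sub]
  · intro x y; simp only [ext2_cst_cst, gau_newMu μ m hm, sub_self]

lemma newMu_deform (m : ℕ) (hm : 1 ≤ m) (g : A →ₗ[K] A) (h : ∀ k, DeformEq μ k) (k : ℕ) :
    DeformEq (newMu μ m g) k := by
  intro x y z
  rw [← alt3_cst, gau_inj m hm g (alt3 (newMu μ m g) (cst x) (cst y) (cst z))]
  · rfl
  · rw [← alt3_zero μ h (gau m g (cst x)) (gau m g (cst y)) (gau m g (cst z))]
    simp only [alt3, map_add, map_sub, gau_ext2 μ m hm]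

lemma nuu_low (m : ℕ) (hm : 1 ≤ m) (g : A →ₗ[K] A) (k : ℕ) (hk : k ≤ m) (x y : A) :
    nuu μ m g k x y = μ k x y - if k = m then μ 0 (g x) y + μ 0 x (g y) else 0 := by
  rw [nuu_apply, gau_cst, gau_cst]
  simp only [ext2_sub_left, ext2_sub_right, ext2_taum_left, ext2_taum_right, ext2_cst_cst,
    Pi.sub_apply, tau_iter]
  rcases hk.lt_or_eq with h | rfl
  · simp [h.ne, h.not_ge]
  · have : ¬ k ≤ 0 := by omega
    simp [this]; abel

end Helpers

/-- If the first nonzero coefficient `μ_m` after `μ₀` of a formal left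
alternative deformation is a coboundary, the deformation is equivalent to
one whose coefficients in degrees `1` through `m` vanish. -/
theorem deformation_kill_coboundary_coefficient
    {K A : Type*} [Field K] [CharZero K] [AddCommGroup A] [Module K A]
    (μ : ℕ → (A →ₗ[K] A →ₗ[K] A))
    (hleft : ∀ x y : A, μ 0 x (μ 0 x y) = μ 0 (μ 0 x x) y)
    (hdef : ∀ k : ℕ, DeformEq μ k)
    (m : ℕ) (hm : 1 ≤ m)
    (hvanish : ∀ i : ℕ, 1 ≤ i → i < m → μ i = 0)
    (g : A →ₗ[K] A)
    (hμm : ∀ x y : A, μ m x y = d1 (μ 0) g x y) :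
    ∃ μ' : ℕ → (A →ₗ[K] A →ₗ[K] A),
      (∀ k : ℕ, DeformEq μ' k) ∧ μ' 0 = μ 0 ∧
      (∀ i : ℕ, 1 ≤ i → i ≤ m → μ' i = 0) ∧
      ∃ Φ : ℕ → (A →ₗ[K] A),
        Φ 0 = LinearMap.id ∧
        ∀ k : ℕ, ∀ x y : A,
          ∑ i ∈ Finset.range (k + 1), Φ i (μ' (k - i) x y) =
            ∑ i ∈ Finset.range (k + 1), ∑ j ∈ Finset.range (k - i + 1),
              μ i (Φ j x) (Φ (k - i - j) y) := by
  have h0 : newMu μ m g 0 = μ 0 := by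
    ext x y
    have : ¬ m ≤ 0 := by omega
    have h' : ¬ 0 = m := by omega
    rw [newMu, dif_neg (by omega), add_zero, nuu_low μ m hm g 0 (by omega)]
    simp [h']
  refine ⟨newMu μ m g, newMu_deform μ m hm g hdef, h0, ?_, phi m g, ?_, ?_⟩
  · intro i hi him
    ext x y
    rcases him.lt_or_eq with h | rfl
    · rw [newMu, dif_neg (by omega), add_zero, nuu_low μ m hm g i him, hvanish i hi h]
      simp [h.ne]
    · rw [newMu, dif_pos ⟨hm, le_rfl⟩, LinearMap.add_apply, LinearMap.add_apply,
        nuu_low μ i hm g i le_rfl, hμm]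
      simp [d1, h0]
  · have h' : ¬ 0 = m := by omega
    simp [phi, h']
  · intro k x y
    rw [phi_sum m g (fun k => newMu μ m g k x y) k, gau_newMu μ m hm]
    simp only [phi_cst]
    unfold ext2
    rw [Finset.Nat.sum_antidiagonal_eq_sum_range_succ (fun i n =>
      ∑ q ∈ Finset.HasAntidiagonal.antidiagonal n, μ i (gau m g (cst x) q.1) (gau m g (cst y) q.2))]
    refine Finset.sum_congr rfl fun i _ => ?_
    rw [Finset.Nat.sum_antidiagonal_eq_sum_range_succ (fun j l =>
      μ i (gau m g (cst x) j) (gau m g (cst y) l))]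
end
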